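/- Let {X_n} be an irreducible and aperiodic Markov chain on a finite alphabet A, with an arbitrary initial distribution and stationary distribution π. Then, as n → ∞, the plug-in estimator of mutual information satisfies Î_n = I_π(X_0;X_1) + O(√(log log n / n)) almost surely. -/

import Mathlib

open MeasureTheory ProbabilityTheory Filter Finset Topology
open scoped NNReal

noncomputable section

/-- Shannon entropy (natural logarithm) of a probability vector on a finite type. -/
def ent {T : Type*} [Fintype T] (p : T → ℝ) : ℝ := ∑ t, Real.negMulLog (p t)

/-- `X` is a homogeneous first-order Markov chain with transition matrix `Q`
(and arbitrary initial distribution). -/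
def IsMarkov {Ω A : Type*} [MeasurableSpace Ω] (μ : Measure Ω) (X : ℕ → Ω → A)
    (Q : A → A → ℝ) : Prop :=
  ∀ (n : ℕ) (w : Fin (n + 1) → A) (a : A),
    (μ {ω | (∀ i : Fin (n + 1), X (i : ℕ) ω = w i) ∧ X (n + 1) ω = a}).toReal
      = Q (w (Fin.last n)) a * (μ {ω | ∀ i : Fin (n + 1), X (i : ℕ) ω = w i}).toReal

/-- Bivariate empirical distribution of consecutive pairs of the sample `x 0, …, x n`. -/
def empPair {A : Type*} [DecidableEq A] (x : ℕ → A) (n : ℕ) (a a' : A) : ℝ :=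
  (∑ i ∈ Finset.range n, if x i = a ∧ x (i + 1) = a' then (1 : ℝ) else 0) / n

/-- First marginal of the bivariate empirical distribution. -/
def empFst {A : Type*} [Fintype A] [DecidableEq A] (x : ℕ → A) (n : ℕ) (a : A) : ℝ :=
  ∑ a', empPair x n a a'

/-- Second marginal of the bivariate empirical distribution. -/
def empSnd {A : Type*} [Fintype A] [DecidableEq A] (x : ℕ → A) (n : ℕ) (a' : A) : ℝ :=
  ∑ a, empPair x n a a'

/-- Univariate empirical distribution of the sample `x 0, …, x (n-1)`. -/
def empOne {A : Type*} [DecidableEq A] (x : ℕ → A) (n : ℕ) (a : A) : ℝ :=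
  (∑ i ∈ Finset.range n, if x i = a then (1 : ℝ) else 0) / n

/-- The plug-in estimator of the mutual information. -/
def pluginMI {A : Type*} [Fintype A] [DecidableEq A] (x : ℕ → A) (n : ℕ) : ℝ :=
  ent (empFst x n) + ent (empSnd x n) - ent (fun p : A × A => empPair x n p.1 p.2)

/-- The stationary mutual information `I_π(X₀; X₁)` of a chain with transition
matrix `Q` and stationary distribution `π`. -/
def Ipi {A : Type*} [Fintype A] (Q : A → A → ℝ) (pi : A → ℝ) : ℝ :=
  ∑ a, ∑ a', pi a * Q a a' * Real.log (Q a a' / pi a')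

/-- Convergence in distribution of real random variables. -/
def TendstoInDistribution {Ω : Type*} [MeasurableSpace Ω] (μ : Measure Ω)
    (W : ℕ → Ω → ℝ) (ν : Measure ℝ) : Prop :=
  ∀ f : BoundedContinuousFunction ℝ ℝ,
    Tendsto (fun n => ∫ ω, f (W n ω) ∂μ) atTop (𝓝 (∫ x, f x ∂ν))

/-- Chi-squared distribution with `s` degrees of freedom, as the Gamma
distribution with shape `s/2` and rate `1/2`. -/
def chiSq (s : ℕ) : Measure ℝ := gammaMeasure ((s : ℝ) / 2) (1 / 2)

/-- Irreducibility and aperiodicity of a finite-state chain, expressed as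
primitivity of its transition matrix. -/
def Primitive {A : Type*} [Fintype A] [DecidableEq A] (Q : Matrix A A ℝ) : Prop :=
  ∃ N : ℕ, 0 < N ∧ ∀ a a', 0 < (Q ^ N) a a'

/-- Relative entropy (Kullback–Leibler divergence, natural logarithm) between
probability vectors on a finite type. -/
def KLdiv {T : Type*} [Fintype T] (p q : T → ℝ) : ℝ :=
  ∑ t, p t * Real.log (p t / q t)



lemma cyl_snoc {Ω A : Type*} (X : ℕ → Ω → A) (k : ℕ) (w : Fin (k + 1) → A) (y : A) (ω : Ω) :
    (∀ i : Fin (k + 1 + 1), X (i : ℕ) ω = (Fin.snoc w y : Fin (k + 1 + 1) → A) i) ↔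
      ((∀ i : Fin (k + 1), X (i : ℕ) ω = w i) ∧ X (k + 1) ω = y) := by
  rw [Fin.forall_fin_succ']
  simp

lemma max_ineq {Ω A : Type*} [MeasurableSpace Ω] [Fintype A]
    (μ : Measure Ω) [IsProbabilityMeasure μ]
    (X : ℕ → Ω → A) (Q : A → A → ℝ) (hQnn : ∀ a a', 0 ≤ Q a a')
    (hMarkov : IsMarkov μ X Q) (D : A → A → ℝ) (l c : ℝ) (hl : 0 ≤ l) (hc : 0 ≤ c)
    (hexp : ∀ x, ∑ y, Q x y * Real.exp (l * D x y) ≤ Real.exp c) (m : ℕ) :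
    ∀ (k : ℕ) (w : Fin (k + 1) → A) (s : ℝ),
      μ.real {ω | (∀ i : Fin (k + 1), X (i : ℕ) ω = w i) ∧
        ∃ n ≤ m, s ≤ ∑ i ∈ range n, D (X (k + i) ω) (X (k + i + 1) ω)}
      ≤ μ.real {ω | ∀ i : Fin (k + 1), X (i : ℕ) ω = w i} * Real.exp (-(l * s) + c * m) := by
  have triv : ∀ (m k : ℕ) (w : Fin (k + 1) → A) (s : ℝ), s ≤ 0 → 
      μ.real {ω | (∀ i : Fin (k + 1), X (i : ℕ) ω = w i) ∧
        ∃ n ≤ m, s ≤ ∑ i ∈ range n, D (X (k + i) ω) (X (k + i + 1) ω)}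
      ≤ μ.real {ω | ∀ i : Fin (k + 1), X (i : ℕ) ω = w i} * Real.exp (-(l * s) + c * m) := by
    intro m k w s hs
    have h1 : 1 ≤ Real.exp (-(l * s) + c * m) := by
      apply Real.one_le_exp
      have := mul_nonneg hc (Nat.cast_nonneg (α := ℝ) m)
      nlinarith
    calc _ ≤ μ.real {ω | ∀ i : Fin (k + 1), X (i : ℕ) ω = w i} :=
          measureReal_mono (fun ω h => h.1)
      _ ≤ _ := le_mul_of_one_le_right measureReal_nonneg h1
  induction m with
  | zero =>
    intro k w s
    by_cases hs : s ≤ 0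
    · exact triv 0 k w s hs
    · have : {ω | (∀ i : Fin (k + 1), X (i : ℕ) ω = w i) ∧
        ∃ n ≤ 0, s ≤ ∑ i ∈ range n, D (X (k + i) ω) (X (k + i + 1) ω)} = ∅ := by
        ext ω
        simp [hs]
      rw [this]
      simp only [measureReal_empty]
      positivity
  | succ m ih =>
    intro k w s
    by_cases hs : s ≤ 0
    · exact triv (m + 1) k w s hs
    · set x := w (Fin.last k) with hx
      have hsub : {ω | (∀ i : Fin (k + 1), X (i : ℕ) ω = w i) ∧
          ∃ n ≤ m + 1, s ≤ ∑ i ∈ range n, D (X (k + i) ω) (X (k + i + 1) ω)} ⊆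
          ⋃ y ∈ (Finset.univ : Finset A), {ω | (∀ i : Fin (k + 1 + 1), X (i : ℕ) ω =
              (Fin.snoc w y : Fin (k + 1 + 1) → A) i) ∧
            ∃ n ≤ m, s - D x y ≤ ∑ i ∈ range n, D (X (k + 1 + i) ω) (X (k + 1 + i + 1) ω)} := by
        rintro ω ⟨h1, n, hn, h2⟩
        simp only [Set.mem_iUnion]
        refine ⟨X (k + 1) ω, Finset.mem_univ _, ?_, ?_⟩
        · exact (cyl_snoc X k w _ ω).2 ⟨h1, rfl⟩
        · cases n with
          | zero => simp at h2; exact absurd h2 hs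
          | succ n =>
            refine ⟨n, by omega, ?_⟩
            rw [Finset.sum_range_succ'] at h2
            have hk : X k ω = x := by simpa using h1 (Fin.last k)
            have : ∀ i, k + (i + 1) = k + 1 + i := fun i => by omega
            rw [add_zero, hk, Finset.sum_congr rfl (fun i _ => by rw [this i])] at h2
            linarith
      calc _ ≤ _ := measureReal_mono hsub (measure_ne_top _ _)
        _ ≤ _ := measureReal_biUnion_finset_le _ _
        _ ≤ ∑ y, (Q x y * μ.real {ω | ∀ i : Fin (k + 1), X (i : ℕ) ω = w i})
              * Real.exp (-(l * (s - D x y)) + c * m) := by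
            apply Finset.sum_le_sum
            intro y _
            refine (ih (k + 1) (Fin.snoc w y) (s - D x y)).trans (le_of_eq ?_)
            congr 1
            simp only [cyl_snoc]
            exact hMarkov k w y
        _ = μ.real {ω | ∀ i : Fin (k + 1), X (i : ℕ) ω = w i} * Real.exp (-(l * s) + c * m) *
              ∑ y, Q x y * Real.exp (l * D x y) := by
            rw [Finset.mul_sum]
            apply Finset.sum_congr rfl
            intro y _
            rw [show -(l * (s - D x y)) + c * m = (-(l * s) + c * m) + l * D x y by ring,
              Real.exp_add]
            ring
        _ ≤ μ.real {ω | ∀ i : Fin (k + 1), X (i : ℕ) ω = w i} * Real.exp (-(l * s) + c * m) *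
              Real.exp c := by
            gcongr
            exact hexp x
        _ = _ := by
            rw [mul_assoc, ← Real.exp_add]
            push_cast
            ring_nf

lemma max_ineq' {Ω A : Type*} [MeasurableSpace Ω] [Fintype A]
    (μ : Measure Ω) [IsProbabilityMeasure μ]
    (X : ℕ → Ω → A) (Q : A → A → ℝ) (hQnn : ∀ a a', 0 ≤ Q a a')
    (hMarkov : IsMarkov μ X Q) (D : A → A → ℝ) (l c : ℝ) (hl : 0 ≤ l) (hc : 0 ≤ c)
    (hexp : ∀ x, ∑ y, Q x y * Real.exp (l * D x y) ≤ Real.exp c) (m : ℕ) (s : ℝ) :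
    μ.real {ω | ∃ n ≤ m, s ≤ ∑ i ∈ range n, D (X i ω) (X (i + 1) ω)}
      ≤ Fintype.card A * Real.exp (-(l * s) + c * m) := by
  have hsub : {ω | ∃ n ≤ m, s ≤ ∑ i ∈ range n, D (X i ω) (X (i + 1) ω)} ⊆
      ⋃ y ∈ (Finset.univ : Finset A), {ω | (∀ i : Fin (0 + 1), X (i : ℕ) ω =
              (fun _ => y : Fin (0 + 1) → A) i) ∧
            ∃ n ≤ m, s ≤ ∑ i ∈ range n, D (X (0 + i) ω) (X (0 + i + 1) ω)} := by
    rintro ω h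
    simp only [Set.mem_iUnion]
    refine ⟨X 0 ω, Finset.mem_univ _, ?_, ?_⟩
    · intro i
      have : (i : ℕ) = 0 := by omega
      rw [this]
    · simpa using h
  calc _ ≤ _ := measureReal_mono hsub (measure_ne_top _ _)
    _ ≤ _ := measureReal_biUnion_finset_le _ _
    _ ≤ ∑ y : A, Real.exp (-(l * s) + c * m) := by
        apply Finset.sum_le_sum
        intro y _
        refine (max_ineq μ X Q hQnn hMarkov D l c hl hc hexp m 0 _ s).trans ?_
        exact mul_le_of_le_one_left (Real.exp_nonneg _) measureReal_le_one
    _ = _ := by simp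

/-- exponential moment bound -/
lemma exp_bound {A : Type*} [Fintype A] (Q : A → A → ℝ) (hQnn : ∀ a a', 0 ≤ Q a a')
    (hQrow : ∀ a, ∑ a', Q a a' = 1) (D : A → A → ℝ) (hD : ∀ x, ∑ y, Q x y * D x y = 0)
    (K : ℝ) (hK : ∀ x y, |D x y| ≤ K) (l : ℝ) (hl : 0 ≤ l) (hlK : l * K ≤ 1) (x : A) :
    ∑ y, Q x y * Real.exp (l * D x y) ≤ Real.exp ((l * K) ^ 2) := by
  have h1 : ∀ y, Real.exp (l * D x y) ≤ 1 + l * D x y + (l * K) ^ 2 := by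
    intro y
    have ha : |l * D x y| ≤ l * K := by
      rw [abs_mul, abs_of_nonneg hl]
      exact mul_le_mul_of_nonneg_left (hK x y) hl
    have hb := Real.abs_exp_sub_one_sub_id_le (ha.trans hlK)
    have hc := (abs_le.1 hb).2
    have hd : (l * D x y) ^ 2 ≤ (l * K) ^ 2 := sq_le_sq' (abs_le.1 ha).1 (abs_le.1 ha).2
    linarith
  calc _ ≤ ∑ y, Q x y * (1 + l * D x y + (l * K) ^ 2) :=
        Finset.sum_le_sum fun y _ => mul_le_mul_of_nonneg_left (h1 y) (hQnn x y)
    _ = (∑ y, Q x y) + l * (∑ y, Q x y * D x y) + (∑ y, Q x y) * (l * K) ^ 2 := by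
        rw [Finset.mul_sum, Finset.sum_mul, ← Finset.sum_add_distrib, ← Finset.sum_add_distrib]
        exact Finset.sum_congr rfl fun y _ => by ring
    _ = (l * K) ^ 2 + 1 := by rw [hQrow, hD]; ring
    _ ≤ _ := Real.add_one_le_exp _

/-- Upper half of the LIL, up to constants. -/
lemma lil_upper {Ω A : Type*} [MeasurableSpace Ω] [Fintype A]
    (μ : Measure Ω) [IsProbabilityMeasure μ]
    (X : ℕ → Ω → A) (Q : A → A → ℝ) (hQnn : ∀ a a', 0 ≤ Q a a')
    (hQrow : ∀ a, ∑ a', Q a a' = 1)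
    (hMarkov : IsMarkov μ X Q) (D : A → A → ℝ) (hD : ∀ x, ∑ y, Q x y * D x y = 0)
    (K : ℝ) (hK0 : 0 < K) (hK : ∀ x y, |D x y| ≤ K) :
    ∀ᵐ ω ∂μ, ∀ᶠ n : ℕ in atTop, ∑ i ∈ range n, D (X i ω) (X (i + 1) ω) ≤
      4 * K * Real.sqrt (n * (2 * Real.log (Real.log n))) := by
  set E : ℕ → Set Ω := fun k => {ω | ∃ n ≤ 2 ^ (k + 1),
    4 * K * Real.sqrt (2 ^ k * Real.log k) ≤ ∑ i ∈ range n, D (X i ω) (X (i + 1) ω)} with hE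
  have hEb : ∀ k : ℕ, 1 ≤ k → μ.real (E k) ≤ Fintype.card A * ((k : ℝ) ^ 2)⁻¹ := by
    intro k hk
    have hk' : (1 : ℝ) ≤ k := by exact_mod_cast hk
    have hlog : 0 ≤ Real.log k := Real.log_nonneg hk'
    have hlog2 : Real.log k ≤ 2 ^ k := by
      have h1 := Real.log_le_self (x := (k : ℝ)) (by linarith)
      have h2 : (k : ℝ) ≤ 2 ^ k := by exact_mod_cast (Nat.lt_two_pow_self (n := k)).le
      linarith
    have h2k : (0 : ℝ) < 2 ^ k := by positivity
    set r := Real.sqrt (Real.log k / 2 ^ k) with hr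
    have hr0 : 0 ≤ r := Real.sqrt_nonneg _
    have hr2 : r ^ 2 = Real.log k / 2 ^ k := Real.sq_sqrt (by positivity)
    have hr1 : r ≤ 1 := by
      rw [hr]; apply Real.sqrt_le_one.2
      rw [div_le_one h2k]; exact hlog2
    have hlK : r / K * K = r := by field_simp
    have hc : 0 ≤ r / K := by positivity
    refine (max_ineq' μ X Q hQnn hMarkov D (r / K) ((r / K * K) ^ 2) hc (sq_nonneg _)
      (exp_bound Q hQnn hQrow D hD K hK (r / K) hc (by rw [hlK]; exact hr1)) (2 ^ (k + 1))
      _).trans ?_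
    gcongr
    have hs : Real.sqrt (2 ^ k * Real.log k) = r * 2 ^ k := by
      rw [Real.sqrt_eq_iff_mul_self_eq (by positivity) (by positivity)]
      have : r * 2 ^ k * (r * 2 ^ k) = r ^ 2 * 2 ^ k * 2 ^ k := by ring
      rw [this, hr2]; field_simp
    rw [hlK, hs]
    have : -(r / K * (4 * K * (r * 2 ^ k))) + r ^ 2 * ((2 ^ (k + 1) : ℕ) : ℝ) =
        - (2 * Real.log k) := by
      have h3 : -(r / K * (4 * K * (r * 2 ^ k))) = - (4 * r ^ 2 * 2 ^ k) := by
        field_simp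
      rw [h3, hr2]; push_cast; field_simp; ring
    rw [this, Real.exp_neg]
    rw [show 2 * Real.log k = Real.log k + Real.log k by ring, Real.exp_add,
      Real.exp_log (by linarith), sq]
  have hsum : ∑' k, μ (E k) ≠ ⊤ := by
    have h1 : Summable fun k : ℕ => μ.real (E k) := by
      have h2 : Summable fun k : ℕ => (Fintype.card A : ℝ) * ((k : ℝ) ^ 2)⁻¹ :=
        (Real.summable_nat_pow_inv.2 (by norm_num)).mul_left _
      refine Summable.of_norm_bounded_eventually_nat h2 ?_
      filter_upwards [eventually_ge_atTop 1] with k hk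
      rw [Real.norm_of_nonneg measureReal_nonneg]
      exact hEb k hk
    have h3 : ∀ k, μ (E k) = ENNReal.ofReal (μ.real (E k)) := fun k => by simp
    simp_rw [h3]
    exact h1.tsum_ofReal_ne_top
  filter_upwards [ae_eventually_notMem hsum] with ω hω
  obtain ⟨k0, hk0⟩ := eventually_atTop.1 hω
  have hlogt : ∀ᶠ n : ℕ in atTop, (Real.log 2)⁻¹ ≤ Real.log n :=
    (Real.tendsto_log_atTop.comp tendsto_natCast_atTop_atTop).eventually_ge_atTop _
  filter_upwards [hlogt, eventually_ge_atTop (2 ^ (k0 + 1))] with n hn1 hn2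
  have hnpos : n ≠ 0 := by
    have : 0 < 2 ^ (k0 + 1) := by positivity
    omega
  set k := Nat.log 2 n with hkdef
  have hk : k0 + 1 ≤ k := (Nat.le_log_iff_pow_le (by norm_num) hnpos).2 hn2
  have hle : 2 ^ k ≤ n := Nat.pow_log_le_self 2 hnpos
  have hlt : n < 2 ^ (k + 1) := Nat.lt_pow_succ_log_self (by norm_num) n
  have hnot := hk0 k (by omega)
  simp only [hE, Set.mem_ofPred_eq, not_exists, not_and, not_le] at hnot
  refine (hnot n hlt.le).le.trans ?_
  have hlog2 : 0 < Real.log 2 := Real.log_pos (by norm_num)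
  have hkk : (k : ℝ) * Real.log 2 ≤ Real.log n := by
    rw [← Real.log_pow]
    apply Real.log_le_log (by positivity)
    exact_mod_cast hle
  have hlogn : 0 < Real.log n := lt_of_lt_of_le (by positivity) hn1
  have hkn : (k : ℝ) ≤ Real.log n * Real.log n := by
    calc (k : ℝ) = k * Real.log 2 * (Real.log 2)⁻¹ := by field_simp
      _ ≤ Real.log n * Real.log n := by gcongr
  have hk1 : (1 : ℝ) ≤ k := by exact_mod_cast (by omega : 1 ≤ k)
  have hllk : Real.log k ≤ 2 * Real.log (Real.log n) := by
    have := Real.log_le_log (by linarith) hkn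
    rw [Real.log_mul hlogn.ne' hlogn.ne'] at this
    linarith
  have : (2 : ℝ) ^ k ≤ n := by exact_mod_cast hle
  have := Real.log_nonneg hk1
  gcongr

lemma zero_trans {Ω A : Type*} [MeasurableSpace Ω] [Fintype A]
    (μ : Measure Ω) [IsProbabilityMeasure μ]
    (X : ℕ → Ω → A) (Q : A → A → ℝ)
    (hMarkov : IsMarkov μ X Q) (a a' : A) (h0 : Q a a' = 0) :
    ∀ᵐ ω ∂μ, ∀ i, ¬ (X i ω = a ∧ X (i + 1) ω = a') := by
  rw [ae_all_iff]
  intro n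
  rw [ae_iff]
  have hsub : {ω | ¬ ¬ (X n ω = a ∧ X (n + 1) ω = a')} ⊆
      ⋃ w : {w : Fin (n + 1) → A // w (Fin.last n) = a},
        {ω | (∀ i : Fin (n + 1), X (i : ℕ) ω = w.1 i) ∧ X (n + 1) ω = a'} := by
    intro ω h
    have h : X n ω = a ∧ X (n + 1) ω = a' := not_not.1 h
    rw [Set.mem_iUnion]
    exact ⟨⟨fun i => X i ω, by simpa using h.1⟩, fun i => rfl, h.2⟩
  refine measure_mono_null hsub (measure_iUnion_null ?_)
  rintro ⟨w, hw⟩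
  have := hMarkov n w a'
  rw [hw, h0, zero_mul, ENNReal.toReal_eq_zero_iff] at this
  exact this.resolve_right (measure_ne_top _ _)

lemma pow_row {A : Type*} [Fintype A] [DecidableEq A] (Q : Matrix A A ℝ)
    (g : A → ℝ) (hg : Matrix.mulVec Q g = g) (N : ℕ) : Matrix.mulVec (Q ^ N) g = g := by
  induction N with
  | zero => simp
  | succ N ih => rw [pow_succ, ← Matrix.mulVec_mulVec, hg, ih]

lemma poisson {A : Type*} [Fintype A] [DecidableEq A] (Q : Matrix A A ℝ) (pi : A → ℝ)
    (hQrow : ∀ a, ∑ a', Q a a' = 1) (hIA : Primitive Q) (hpi1 : ∑ a, pi a = 1)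
    (hpistat : ∀ a', ∑ a, pi a * Q a a' = pi a') (f : A → ℝ) (hf : ∑ a, pi a * f a = 0) :
    ∃ g : A → ℝ, ∀ x, g x - ∑ y, Q x y * g y = f x := by
  obtain ⟨N, -, hN⟩ := hIA
  have hA : Nonempty A := by
    by_contra h
    rw [not_nonempty_iff] at h
    simp at hpi1
  have hone : Matrix.mulVec Q (fun _ => (1 : ℝ)) = fun _ => 1 := by
    ext x; simp [Matrix.mulVec, dotProduct, hQrow]
  have honeN := pow_row Q _ hone N
  set T : (A → ℝ) →ₗ[ℝ] (A → ℝ) := LinearMap.id - Matrix.mulVecLin Q with hT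
  set φ : (A → ℝ) →ₗ[ℝ] ℝ := Fintype.linearCombination ℝ pi with hφ
  have hφa : ∀ g, φ g = ∑ a, pi a * g a := by
    intro g
    simp [hφ, Fintype.linearCombination_apply, mul_comm]
  have hTa : ∀ g x, T g x = g x - ∑ y, Q x y * g y := by
    intro g x
    simp [hT, Matrix.mulVec, dotProduct]
  have hker : LinearMap.ker T ≤ Submodule.span ℝ {fun _ : A => (1 : ℝ)} := by
    intro g hg
    have hg1 : Matrix.mulVec Q g = g := by
      have : T g = 0 := hg
      simp only [hT, LinearMap.sub_apply, LinearMap.id_apply, Matrix.mulVecLin_apply] at this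
      exact (sub_eq_zero.1 this).symm
    have hgN := pow_row Q g hg1 N
    obtain ⟨x0, hx0⟩ := Finite.exists_max g
    have h1 : ∑ y, (Q ^ N) x0 y * (g x0 - g y) = 0 := by
      have e1 := congrFun hgN x0
      have e2 := congrFun honeN x0
      simp only [Matrix.mulVec, dotProduct, mul_one] at e1 e2
      simp only [mul_sub, Finset.sum_sub_distrib, ← Finset.sum_mul, e1, e2]
      ring
    rw [Finset.sum_eq_zero_iff_of_nonneg
      (fun y _ => mul_nonneg (hN x0 y).le (sub_nonneg.2 (hx0 y)))] at h1
    rw [Submodule.mem_span_singleton]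
    refine ⟨g x0, ?_⟩
    ext y
    have := (mul_eq_zero.1 (h1 y (Finset.mem_univ y))).resolve_left (hN x0 y).ne'
    simp; linarith
  have hkf : Module.finrank ℝ (LinearMap.ker T) ≤ 1 :=
    (Submodule.finrank_mono hker).trans ((finrank_span_le_card _).trans (by simp))
  have hle : LinearMap.range T ≤ LinearMap.ker φ := by
    rintro _ ⟨g, rfl⟩
    rw [LinearMap.mem_ker, hφa]
    simp only [hTa, mul_sub, Finset.sum_sub_distrib, Finset.mul_sum]
    rw [Finset.sum_comm]
    rw [sub_eq_zero]
    apply Finset.sum_congr rfl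
    intro y _
    rw [← hpistat y, Finset.sum_mul]
    exact Finset.sum_congr rfl fun x _ => by ring
  have hφr : LinearMap.range φ = ⊤ := by
    apply LinearMap.range_eq_top.2
    intro c
    refine ⟨fun _ => c, ?_⟩
    rw [hφa, ← Finset.sum_mul, hpi1, one_mul]
  have e1 := LinearMap.finrank_range_add_finrank_ker T
  have e2 := LinearMap.finrank_range_add_finrank_ker φ
  rw [hφr, finrank_top, Module.finrank_self] at e2
  have heq := Submodule.eq_of_le_of_finrank_le hle (by omega)
  have hfm : f ∈ LinearMap.range T := by
    rw [heq, LinearMap.mem_ker, hφa]; exact hf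
  obtain ⟨g, hg⟩ := hfm
  exact ⟨g, fun x => by rw [← hTa, hg]⟩

lemma pi_pos {A : Type*} [Fintype A] [DecidableEq A] (Q : Matrix A A ℝ) (pi : A → ℝ)
    (hIA : Primitive Q) (hpiNN : ∀ a, 0 ≤ pi a) (hpi1 : ∑ a, pi a = 1)
    (hpistat : ∀ a', ∑ a, pi a * Q a a' = pi a') (a : A) : 0 < pi a := by
  obtain ⟨N, -, hN⟩ := hIA
  have h1 : Matrix.vecMul pi Q = pi := by
    ext x; simp [Matrix.vecMul, dotProduct, hpistat]
  have h2 : ∀ M : ℕ, Matrix.vecMul pi (Q ^ M) = pi := by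
    intro M
    induction M with
    | zero => simp
    | succ M ih => rw [pow_succ, ← Matrix.vecMul_vecMul, ih, h1]
  have h3 := congrFun (h2 N) a
  simp only [Matrix.vecMul, dotProduct] at h3
  rw [← h3]
  have : ∃ b, 0 < pi b := by
    by_contra h
    push Not at h
    have := Finset.sum_nonpos (s := Finset.univ) (f := pi) fun b _ => h b
    linarith
  obtain ⟨b, hb⟩ := this
  exact Finset.sum_pos' (fun x _ => mul_nonneg (hpiNN x) (hN x a).le)
    ⟨b, Finset.mem_univ b, mul_pos hb (hN b a)⟩

/-- The LIL rate. -/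
def lilRate (n : ℕ) : ℝ := Real.sqrt (Real.log (Real.log (n : ℝ)) / n)

lemma loglog_tendsto : Tendsto (fun n : ℕ => Real.log (Real.log (n : ℝ))) atTop atTop :=
  Real.tendsto_log_atTop.comp (Real.tendsto_log_atTop.comp tendsto_natCast_atTop_atTop)

lemma lilRate_tendsto : Tendsto lilRate atTop (𝓝 0) := by
  have h1 : Tendsto (fun n : ℕ => Real.log (n : ℝ) / n) atTop (𝓝 0) :=
    (Real.isLittleO_log_id_atTop.tendsto_div_nhds_zero).comp tendsto_natCast_atTop_atTop
  have h2 : Tendsto (fun n : ℕ => Real.log (Real.log (n : ℝ)) / n) atTop (𝓝 0) := by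
    refine squeeze_zero' ?_ ?_ h1
    · filter_upwards [loglog_tendsto.eventually_ge_atTop 0] with n hn
      positivity
    · filter_upwards [(Real.tendsto_log_atTop.comp
        tendsto_natCast_atTop_atTop).eventually_ge_atTop (0 : ℝ)] with n hn
      exact div_le_div_of_nonneg_right (Real.log_le_self hn) (Nat.cast_nonneg n)
  have h3 := (Real.continuous_sqrt.tendsto 0).comp h2
  rw [Real.sqrt_zero] at h3
  exact h3

lemma emp_lil {Ω A : Type*} [MeasurableSpace Ω] [Fintype A] [DecidableEq A]
    (μ : Measure Ω) [IsProbabilityMeasure μ]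
    (X : ℕ → Ω → A) (Q : Matrix A A ℝ) (pi : A → ℝ)
    (hQnn : ∀ a a', 0 ≤ Q a a') (hQrow : ∀ a, ∑ a', Q a a' = 1)
    (hMarkov : IsMarkov μ X fun a a' => Q a a')
    (hIA : Primitive Q) (hpi1 : ∑ a, pi a = 1)
    (hpistat : ∀ a', ∑ a, pi a * Q a a' = pi a') (a a' : A) :
    ∀ᵐ ω ∂μ, (fun n => empPair (fun i => X i ω) n a a' - pi a * Q a a') =O[atTop] lilRate := by
  set h : A → A → ℝ := fun x y => if x = a ∧ y = a' then 1 else 0 with hh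
  set m := pi a * Q a a' with hm
  have hbar : ∀ x, ∑ y, Q x y * h x y = if x = a then Q a a' else 0 := by
    intro x
    by_cases hx : x = a
    · subst hx; simp [hh]
    · simp [hh, hx]
  obtain ⟨g, hg⟩ := poisson Q pi hQrow hIA hpi1 hpistat
    (fun x => (∑ y, Q x y * h x y) - m) (by
      simp only [hbar, mul_sub, Finset.sum_sub_distrib, ← Finset.sum_mul, hpi1]
      simp [hm])
  set D : A → A → ℝ := fun x y => h x y - m + g y - g x with hDdef
  have hD : ∀ x, ∑ y, Q x y * D x y = 0 := by
    intro x
    have e : ∑ y, Q x y * D x y = (∑ y, Q x y * h x y) - (∑ y, Q x y) * m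
        + (∑ y, Q x y * g y) - (∑ y, Q x y) * g x := by
      simp only [Finset.sum_mul, ← Finset.sum_add_distrib, ← Finset.sum_sub_distrib]
      exact Finset.sum_congr rfl fun y _ => by simp only [hDdef]; ring
    have := hg x
    rw [e, hQrow]; linarith
  obtain ⟨G, hG⟩ : ∃ G, ∀ x, |g x| ≤ G := by
    refine ⟨∑ x, |g x|, fun x => ?_⟩
    exact Finset.single_le_sum (f := fun x => |g x|) (fun _ _ => abs_nonneg _) (Finset.mem_univ x)
  obtain ⟨K, hK0, hK⟩ : ∃ K, 0 < K ∧ ∀ x y, |D x y| ≤ K := by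
    refine ⟨1 + ∑ p : A × A, |D p.1 p.2|, ?_, fun x y => ?_⟩
    · have : 0 ≤ ∑ p : A × A, |D p.1 p.2| := Finset.sum_nonneg fun _ _ => abs_nonneg _
      linarith
    · have := Finset.single_le_sum (f := fun p : A × A => |D p.1 p.2|)
        (fun _ _ => abs_nonneg _) (Finset.mem_univ (x, y))
      simp only at this
      linarith
  have u1 := lil_upper μ X (fun a a' => Q a a') hQnn hQrow hMarkov D hD K hK0 hK
  have u2 := lil_upper μ X (fun a a' => Q a a') hQnn hQrow hMarkov (fun x y => - D x y)
    (fun x => by simp [hD x]) K hK0 (fun x y => by rw [abs_neg]; exact hK x y)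
  filter_upwards [u1, u2] with ω v1 v2
  refine Asymptotics.IsBigO.of_bound (4 * K * Real.sqrt 2 + 2 * G) ?_
  filter_upwards [v1, v2, loglog_tendsto.eventually_ge_atTop 1, eventually_ge_atTop 1]
    with n w1 w2 hll hn
  have hn' : (1 : ℝ) ≤ n := by exact_mod_cast hn
  have hn0 : (0 : ℝ) < n := by linarith
  have hr0 : 0 ≤ lilRate n := Real.sqrt_nonneg _
  have hS : ∑ i ∈ range n, D (X i ω) (X (i + 1) ω) =
      n * (empPair (fun i => X i ω) n a a' - m) + (g (X n ω) - g (X 0 ω)) := by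
    have t := Finset.sum_range_sub (fun i => g (X i ω)) n
    have e1 : n * (empPair (fun i => X i ω) n a a' - m) =
        ∑ i ∈ range n, (h (X i ω) (X (i + 1) ω) - m) := by
      rw [Finset.sum_sub_distrib]
      simp only [empPair, hh, Finset.sum_const, Finset.card_range, nsmul_eq_mul]
      field_simp
    rw [← t, e1, ← Finset.sum_add_distrib]
    exact Finset.sum_congr rfl fun i _ => by simp only [hDdef]; ring
  have hsq : Real.sqrt (n * (2 * Real.log (Real.log n))) = Real.sqrt 2 * (n * lilRate n) := by
    have : (n : ℝ) * (2 * Real.log (Real.log n)) =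
        2 * (n ^ 2 * (Real.log (Real.log n) / n)) := by field_simp
    rw [this, Real.sqrt_mul (by norm_num), Real.sqrt_mul (by positivity),
      Real.sqrt_sq hn0.le, lilRate]
  have hone : 1 ≤ n * lilRate n := by
    have : n * lilRate n = Real.sqrt (n * Real.log (Real.log n)) := by
      have e : (n : ℝ) * Real.log (Real.log n) =
        (n ^ 2 * (Real.log (Real.log n) / n)) := by field_simp
      rw [e, Real.sqrt_mul (by positivity), Real.sqrt_sq hn0.le, lilRate]
    rw [this]
    apply Real.one_le_sqrt.2
    nlinarith
  rw [hsq] at w1 w2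
  simp only [Finset.sum_neg_distrib] at w2
  rw [hS] at w1 w2
  have g1 := abs_le.1 (hG (X n ω))
  have g2 := abs_le.1 (hG (X 0 ω))
  have hG0 : 0 ≤ G := (abs_nonneg _).trans (hG (X 0 ω))
  rw [Real.norm_eq_abs, Real.norm_of_nonneg hr0]
  have key : n * |empPair (fun i => X i ω) n a a' - m| ≤
      n * ((4 * K * Real.sqrt 2 + 2 * G) * lilRate n) := by
    rw [← abs_of_pos hn0, ← abs_mul, abs_of_pos hn0, abs_le]
    constructor <;> nlinarith
  exact le_of_mul_le_mul_left key hn0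

lemma negMulLog_bigO (u : ℕ → ℝ) (p : ℝ) (hp : p = 0 → ∀ n, u n = 0)
    (hu : (fun n => u n - p) =O[atTop] lilRate) :
    (fun n => Real.negMulLog (u n) - Real.negMulLog p) =O[atTop] lilRate := by
  by_cases h0 : p = 0
  · have := hp h0
    simp only [this, h0, sub_self]
    exact Asymptotics.isBigO_zero _ _
  · have ht : Tendsto u atTop (𝓝 p) := by
      have := hu.trans_tendsto lilRate_tendsto
      simpa using this.add_const p
    exact ((Real.hasDerivAt_negMulLog h0).isBigO_sub.comp_tendsto ht).trans hu

lemma ent_bigO {T : Type*} [Fintype T] (u : ℕ → T → ℝ) (p : T → ℝ)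
    (hp : ∀ t, p t = 0 → ∀ n, u n t = 0)
    (hu : ∀ t, (fun n => u n t - p t) =O[atTop] lilRate) :
    (fun n => ent (u n) - ent p) =O[atTop] lilRate := by
  simp only [ent, ← Finset.sum_sub_distrib]
  exact Asymptotics.IsBigO.fun_sum fun t _ => negMulLog_bigO (fun n => u n t) (p t) (hp t) (hu t)

lemma Ipi_eq {A : Type*} [Fintype A] (Q : A → A → ℝ) (pi : A → ℝ)
    (hQrow : ∀ a, ∑ a', Q a a' = 1) (hpos : ∀ a, 0 < pi a)
    (hpistat : ∀ a', ∑ a, pi a * Q a a' = pi a') :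
    Ipi Q pi = ent pi + ent pi - ent (fun p : A × A => pi p.1 * Q p.1 p.2) := by
  have h1 : ent pi = ∑ a, ∑ a', -(pi a * Q a a' * Real.log (pi a)) := by
    unfold ent
    apply Finset.sum_congr rfl
    intro a _
    rw [Finset.sum_neg_distrib, ← Finset.sum_mul, ← Finset.mul_sum, hQrow, Real.negMulLog]
    ring
  have h2 : ent pi = ∑ a, ∑ a', -(pi a * Q a a' * Real.log (pi a')) := by
    unfold ent
    rw [Finset.sum_comm]
    apply Finset.sum_congr rfl
    intro a _
    rw [Finset.sum_neg_distrib, ← Finset.sum_mul, hpistat, Real.negMulLog]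
    ring
  nth_rewrite 1 [h1]
  rw [h2]
  unfold ent Ipi
  rw [Fintype.sum_prod_type]
  simp only [← Finset.sum_add_distrib, ← Finset.sum_sub_distrib]
  refine Finset.sum_congr rfl fun a _ => Finset.sum_congr rfl fun a' _ => ?_
  by_cases hq : Q a a' = 0
  · simp [hq]
  · rw [Real.negMulLog, Real.log_div hq (hpos a').ne', Real.log_mul (hpos a).ne' hq]
    ring

/-- **Corollary 1** (Kontoyiannis–Skoularidou): for an irreducible and aperiodic
chain, the plug-in estimator of mutual information satisfies
`Î_n = I_π(X₀;X₁) + O(√(log log n / n))` almost surely. -/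
theorem stmt3 {Ω A : Type*} [MeasurableSpace Ω]
    [MeasurableSpace A] [Fintype A] [DecidableEq A]
    (μ : Measure Ω) [IsProbabilityMeasure μ]
    (X : ℕ → Ω → A) (Q : Matrix A A ℝ) (pi : A → ℝ)
    (hXmeas : ∀ i, Measurable (X i))
    (hQnn : ∀ a a', 0 ≤ Q a a') (hQrow : ∀ a, ∑ a', Q a a' = 1)
    (hMarkov : IsMarkov μ X fun a a' => Q a a')
    (hIA : Primitive Q)
    (hpiNN : ∀ a, 0 ≤ pi a) (hpi1 : ∑ a, pi a = 1)
    (hpistat : ∀ a', ∑ a, pi a * Q a a' = pi a') :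
    ∀ᵐ ω ∂μ, ∃ C : ℝ, ∀ᶠ n : ℕ in atTop,
      |pluginMI (fun i => X i ω) n - Ipi (fun a a' => Q a a') pi|
        ≤ C * Real.sqrt (Real.log (Real.log (n : ℝ)) / n) := by
  have hpos := pi_pos Q pi hIA hpiNN hpi1 hpistat
  have h1 : ∀ᵐ ω ∂μ, ∀ a a', (fun n => empPair (fun i => X i ω) n a a' - pi a * Q a a')
      =O[atTop] lilRate := by
    rw [ae_all_iff]; intro a
    rw [ae_all_iff]; intro a'
    exact emp_lil μ X Q pi hQnn hQrow hMarkov hIA hpi1 hpistat a a'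
  have h2 : ∀ᵐ ω ∂μ, ∀ a a', Q a a' = 0 → ∀ i, ¬ (X i ω = a ∧ X (i + 1) ω = a') := by
    rw [ae_all_iff]; intro a
    rw [ae_all_iff]; intro a'
    by_cases h0 : Q a a' = 0
    · filter_upwards [zero_trans μ X (fun a a' => Q a a') hMarkov a a' h0] with ω hω _
      exact hω
    · exact Eventually.of_forall fun ω h => absurd h h0
  filter_upwards [h1, h2] with ω w1 w2
  have e1 := ent_bigO (fun n => empFst (fun i => X i ω) n) pi
    (fun t ht => absurd ht (hpos t).ne') (fun a => by
      have : ∀ n, empFst (fun i => X i ω) n a - pi a =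
          ∑ a', (empPair (fun i => X i ω) n a a' - pi a * Q a a') := by
        intro n
        rw [Finset.sum_sub_distrib, ← Finset.mul_sum, hQrow, mul_one, empFst]
      simp only [this]
      exact Asymptotics.IsBigO.fun_sum fun a' _ => w1 a a')
  have e2 := ent_bigO (fun n => empSnd (fun i => X i ω) n) pi
    (fun t ht => absurd ht (hpos t).ne') (fun a' => by
      have : ∀ n, empSnd (fun i => X i ω) n a' - pi a' =
          ∑ a, (empPair (fun i => X i ω) n a a' - pi a * Q a a') := by
        intro n
        rw [Finset.sum_sub_distrib, hpistat, empSnd]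
      simp only [this]
      exact Asymptotics.IsBigO.fun_sum fun a _ => w1 a a')
  have e3 := ent_bigO (fun n => fun p : A × A => empPair (fun i => X i ω) n p.1 p.2)
    (fun p => pi p.1 * Q p.1 p.2)
    (fun p hp n => by
      have hq : Q p.1 p.2 = 0 := (mul_eq_zero.1 hp).resolve_left (hpos p.1).ne'
      have := w2 p.1 p.2 hq
      simp [empPair, this]) (fun p => w1 p.1 p.2)
  have e4 := (e1.add e2).sub e3
  obtain ⟨C, hC⟩ := e4.bound
  refine ⟨C, ?_⟩
  filter_upwards [hC] with n hn
  have hr : 0 ≤ lilRate n := Real.sqrt_nonneg _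
  rw [Ipi_eq (fun a a' => Q a a') pi hQrow hpos hpistat, pluginMI]
  rw [Real.norm_eq_abs, Real.norm_of_nonneg hr] at hn
  refine le_trans (le_of_eq ?_) hn
  congr 1
  ring

end
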